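/- Assume there exists a pair (P,S) of a probability measure P with P{ω} > 0 for all ω and a P-martingale S satisfying S^b_t ≤ S_t ≤ S^a_t for all t. Let (ξ,ζ) be an adapted ℝ²-valued payoff process. Then for every δ > 0, every mixed stopping time χ and every pair (P̄,S̄) ∈ barP(χ), there exists a pair (P^δ,S^δ) ∈ P(χ) such that | E_{P^δ}((ξ + S^δ ζ)_χ) − E_{P̄}((ξ + S̄ ζ)_χ) | < δ. -/

import Mathlib

open MeasureTheory
open scoped Pointwise

noncomputable section

namespace RZ

variable {Ω : Type*} [Fintype Ω]

/-- `ω` and `ω'` lie in the same atom of the σ-field `m`. -/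
def sameAtom (m : MeasurableSpace Ω) (ω ω' : Ω) : Prop :=
  ∀ A : Set Ω, MeasurableSet[m] A → (ω ∈ A ↔ ω' ∈ A)

/-- Elementary conditional expectation w.r.t. a σ-field on a finite space:
at `ω` it is the `P`-average of `f` over the atom of `ω`. -/
def condExp (m : MeasurableSpace Ω) (P : Ω → ℝ) (f : Ω → ℝ) (ω : Ω) : ℝ :=
  (∑ ω' : Ω, Set.indicator {ω'' | sameAtom m ω ω''} (fun ω'' => P ω'' * f ω'') ω') /
  (∑ ω' : Ω, Set.indicator {ω'' | sameAtom m ω ω''} P ω')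

/-- Expectation under `P`. -/
def expect (P : Ω → ℝ) (f : Ω → ℝ) : ℝ := ∑ ω : Ω, P ω * f ω

/-- Discrete market model with proportional transaction costs. -/
structure Market (Ω : Type*) [Fintype Ω] where
  T : ℕ
  T_pos : 0 < T
  F : ℕ → MeasurableSpace Ω
  F_mono : ∀ ⦃s t : ℕ⦄, s ≤ t → F s ≤ F t
  F_zero : F 0 = ⊥
  F_top : F T = ⊤
  Q : Ω → ℝ
  Q_pos : ∀ ω, 0 < Q ω
  Q_sum : ∑ ω, Q ω = 1
  Sb : ℕ → Ω → ℝ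
  Sa : ℕ → Ω → ℝ
  Sb_pos : ∀ t ω, t ≤ T → 0 < Sb t ω
  Sb_le_Sa : ∀ t ω, t ≤ T → Sb t ω ≤ Sa t ω
  Sb_adapted : ∀ t, t ≤ T → Measurable[F t] (Sb t)
  Sa_adapted : ∀ t, t ≤ T → Measurable[F t] (Sa t)

variable (M : Market Ω)

/-- Liquidation value θ_t(γ, δ) in scenario ω, for a cash position γ and stock position δ. -/
def liq (t : ℕ) (ω : Ω) (γ δ : ℝ) : ℝ :=
  γ + M.Sb t ω * max δ 0 - M.Sa t ω * max (-δ) 0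

/-- An adapted (real-valued) process. -/
def IsAdapted (X : ℕ → Ω → ℝ) : Prop := ∀ t, t ≤ M.T → Measurable[M.F t] (X t)

/-- An adapted ℝ²-valued payoff process. -/
def AdaptedPair (ξ ζ : ℕ → Ω → ℝ) : Prop := IsAdapted M ξ ∧ IsAdapted M ζ

/-- Self-financing strategy. -/
def SelfFinancing (α β : ℕ → Ω → ℝ) : Prop :=
  Measurable[M.F 0] (α 0) ∧ Measurable[M.F 0] (β 0) ∧
  (∀ t, t < M.T → Measurable[M.F t] (α (t + 1)) ∧ Measurable[M.F t] (β (t + 1))) ∧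
  (∀ t, t < M.T → ∀ ω, 0 ≤ liq M t ω (α t ω - α (t + 1) ω) (β t ω - β (t + 1) ω))

/-- Pure stopping time with values in {0,...,T}. -/
def IsStop (τ : Ω → ℕ) : Prop :=
  (∀ ω, τ ω ≤ M.T) ∧ ∀ t : ℕ, MeasurableSet[M.F t] {ω | τ ω = t}

/-- Seller superhedging strategy. -/
def SellerHedge (ξ ζ α β : ℕ → Ω → ℝ) : Prop :=
  SelfFinancing M α β ∧
  ∀ τ, IsStop M τ → ∀ ω,
    0 ≤ liq M (τ ω) ω (α (τ ω) ω - ξ (τ ω) ω) (β (τ ω) ω - ζ (τ ω) ω)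

/-- Buyer superhedging strategy. -/
def BuyerHedge (ξ ζ α β : ℕ → Ω → ℝ) : Prop :=
  SelfFinancing M α β ∧
  ∃ τ, IsStop M τ ∧ ∀ ω,
    0 ≤ liq M (τ ω) ω (α (τ ω) ω + ξ (τ ω) ω) (β (τ ω) ω + ζ (τ ω) ω)

/-- Seller's (ask) price: infimum of the initial costs of seller superhedging strategies. -/
def askPrice (ξ ζ : ℕ → Ω → ℝ) : ℝ :=
  sInf {x | ∃ α β, SellerHedge M ξ ζ α β ∧ ∀ ω, x = -liq M 0 ω (-α 0 ω) (-β 0 ω)}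

/-- Buyer's (bid) price: supremum of the amounts raised by buyer superhedging strategies. -/
def bidPrice (ξ ζ : ℕ → Ω → ℝ) : ℝ :=
  sSup {x | ∃ α β, BuyerHedge M ξ ζ α β ∧ ∀ ω, x = liq M 0 ω (-α 0 ω) (-β 0 ω)}

/-- Mixed stopping time. -/
def IsMixedStop (χ : ℕ → Ω → ℝ) : Prop :=
  (∀ t, t ≤ M.T → Measurable[M.F t] (χ t)) ∧ (∀ t ω, 0 ≤ χ t ω) ∧
  ∀ ω, ∑ t ∈ Finset.range (M.T + 1), χ t ω = 1

/-- χ*_t = Σ_{s=t}^T χ_s  (so χ*_{T+1} = 0). -/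
def chiStar (χ : ℕ → Ω → ℝ) (t : ℕ) (ω : Ω) : ℝ := ∑ s ∈ Finset.Icc t M.T, χ s ω

/-- Z^{χ*}_t = Σ_{s=t}^T χ_s Z_s  (so Z^{χ*}_{T+1} = 0). -/
def starVal (χ Z : ℕ → Ω → ℝ) (t : ℕ) (ω : Ω) : ℝ :=
  ∑ s ∈ Finset.Icc t M.T, χ s ω * Z s ω

/-- Z_χ = Σ_{t=0}^T χ_t Z_t. -/
def mixVal (χ Z : ℕ → Ω → ℝ) (ω : Ω) : ℝ :=
  ∑ t ∈ Finset.range (M.T + 1), χ t ω * Z t ω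

/-- Membership in the family barP(χ). -/
def memBarP (χ : ℕ → Ω → ℝ) (P : Ω → ℝ) (S : ℕ → Ω → ℝ) : Prop :=
  (∀ ω, 0 ≤ P ω) ∧ (∑ ω, P ω) = 1 ∧ IsAdapted M S ∧
  (∀ t ω, t ≤ M.T → M.Sb t ω ≤ S t ω ∧ S t ω ≤ M.Sa t ω) ∧
  (∀ t, t ≤ M.T → ∀ ω, 0 < P ω →
    chiStar M χ (t + 1) ω * M.Sb t ω ≤ condExp (M.F t) P (starVal M χ S (t + 1)) ω ∧
    condExp (M.F t) P (starVal M χ S (t + 1)) ω ≤ chiStar M χ (t + 1) ω * M.Sa t ω)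

/-- Membership in the family P(χ): barP(χ) with P equivalent to Q. -/
def memP (χ : ℕ → Ω → ℝ) (P : Ω → ℝ) (S : ℕ → Ω → ℝ) : Prop :=
  memBarP M χ P S ∧ ∀ ω, 0 < P ω

/-- The mixed stopping time χ^τ associated with a pure stopping time τ. -/
def pureChi (τ : Ω → ℕ) : ℕ → Ω → ℝ := fun t ω => if τ ω = t then 1 else 0

/-- Arbitrage-free: there is an equivalent probability measure and a martingale
between the bid and ask prices. -/
def ArbitrageFree : Prop :=
  ∃ (P : Ω → ℝ) (S : ℕ → Ω → ℝ),
    (∀ ω, 0 < P ω) ∧ (∑ ω, P ω) = 1 ∧ IsAdapted M S ∧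
    (∀ t ω, t ≤ M.T → M.Sb t ω ≤ S t ω ∧ S t ω ≤ M.Sa t ω) ∧
    (∀ t, t < M.T → ∀ ω, 0 < P ω → condExp (M.F t) P (S (t + 1)) ω = S t ω)

/-- Epigraph of a function ℝ → ℝ, as a subset of ℝ² (first coordinate dominates). -/
def epi (f : ℝ → ℝ) : Set (ℝ × ℝ) := {p | f p.2 ≤ p.1}

/-- The function h_{[b,a]}(y) = a y⁻ − b y⁺. -/
def hfun (b a : ℝ) (y : ℝ) : ℝ := a * max (-y) 0 - b * max y 0

/-- Seller's payoff function u_t(y) = ξ_t + (y − ζ_t)⁻ S^a_t − (y − ζ_t)⁺ S^b_t. -/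
def uSell (ξ ζ : ℕ → Ω → ℝ) (t : ℕ) (ω : Ω) (y : ℝ) : ℝ :=
  ξ t ω + M.Sa t ω * max (ζ t ω - y) 0 - M.Sb t ω * max (y - ζ t ω) 0

/-- Buyer's payoff function u_t(y) = −ξ_t + (y + ζ_t)⁻ S^a_t − (y + ζ_t)⁺ S^b_t. -/
def uBuy (ξ ζ : ℕ → Ω → ℝ) (t : ℕ) (ω : Ω) (y : ℝ) : ℝ :=
  -ξ t ω + M.Sa t ω * max (-(y + ζ t ω)) 0 - M.Sb t ω * max (y + ζ t ω) 0

/-- The seller's pricing recursion: one function per atom,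
`z_T = u_T` and `epi z_{t-1} = epi u_{t-1} ∩ (epi h + ⋂_{succ} epi z_t)`. -/
def SellerRec (ξ ζ : ℕ → Ω → ℝ) (z : ℕ → Ω → ℝ → ℝ) : Prop :=
  (∀ t ω ω', t ≤ M.T → sameAtom (M.F t) ω ω' → z t ω = z t ω') ∧
  (∀ ω, z M.T ω = uSell M ξ ζ M.T ω) ∧
  (∀ t ω, t < M.T →
    epi (z t ω) = epi (uSell M ξ ζ t ω) ∩
      (epi (hfun (M.Sb t ω) (M.Sa t ω)) +
        ⋂ ω' ∈ {ω'' | sameAtom (M.F t) ω ω''}, epi (z (t + 1) ω')))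

/-- The buyer's pricing recursion: one function per atom,
`z_T = u_T` and `epi z_{t-1} = epi u_{t-1} ∪ (epi h + ⋂_{succ} epi z_t)`. -/
def BuyerRec (ξ ζ : ℕ → Ω → ℝ) (z : ℕ → Ω → ℝ → ℝ) : Prop :=
  (∀ t ω ω', t ≤ M.T → sameAtom (M.F t) ω ω' → z t ω = z t ω') ∧
  (∀ ω, z M.T ω = uBuy M ξ ζ M.T ω) ∧
  (∀ t ω, t < M.T →
    epi (z t ω) = epi (uBuy M ξ ζ t ω) ∪
      (epi (hfun (M.Sb t ω) (M.Sa t ω)) +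
        ⋂ ω' ∈ {ω'' | sameAtom (M.F t) ω ω''}, epi (z (t + 1) ω')))

section Atoms

variable {α : Type*} {m m' : MeasurableSpace α}

theorem sameAtom.symm {ω ω' : α} (h : sameAtom m ω ω') : sameAtom m ω' ω :=
  fun A hA => (h A hA).symm

theorem sameAtom.trans {ω ω' ω'' : α} (h : sameAtom m ω ω') (h' : sameAtom m ω' ω'') :
    sameAtom m ω ω'' :=
  fun A hA => (h A hA).trans (h' A hA)

theorem sameAtom.refl (m : MeasurableSpace α) (ω : α) : sameAtom m ω ω := fun _ _ => Iff.rfl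

theorem sameAtom.mono (hm : m ≤ m') {ω ω' : α} (h : sameAtom m' ω ω') : sameAtom m ω ω' :=
  fun A hA => h A (hm A hA)

/-- `f` is constant on the atoms of `m`. -/
def AtomConst (m : MeasurableSpace α) (f : α → ℝ) : Prop :=
  ∀ ω ω', sameAtom m ω ω' → f ω = f ω'

theorem AtomConst.of_measurable {f : α → ℝ} (hf : Measurable[m] f) : AtomConst m f :=
  fun ω _ h => ((h (f ⁻¹' {f ω}) (hf (measurableSet_singleton _))).1 rfl).symm

theorem AtomConst.mono (hm : m ≤ m') {f : α → ℝ} (hf : AtomConst m f) : AtomConst m' f :=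
  fun ω ω' h => hf ω ω' (h.mono hm)

theorem AtomConst.mul {f g : α → ℝ} (hf : AtomConst m f) (hg : AtomConst m g) :
    AtomConst m (fun ω => f ω * g ω) :=
  fun ω ω' h => by simp only [hf ω ω' h, hg ω ω' h]

theorem atomConst_indicator_atom (m : MeasurableSpace α) (ω : α) :
    AtomConst m (Set.indicator {ω' | sameAtom m ω ω'} fun _ => 1) := by
  intro a b h
  by_cases ha : sameAtom m ω a
  · have hb : sameAtom m ω b := ha.trans h
    simp [ha, hb]
  · have hb : ¬ sameAtom m ω b := fun hb => ha (hb.trans h.symm)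
    simp [ha, hb]

end Atoms

section AtomSums

variable {m : MeasurableSpace Ω}

theorem measurableSet_atom (m : MeasurableSpace Ω) (ω : Ω) :
    MeasurableSet[m] {ω' | sameAtom m ω ω'} := by
  have h : {ω' | sameAtom m ω ω'} =
      ⋂₀ {A : Set Ω | MeasurableSet[m] A ∧ ω ∈ A} := by
    ext ω'
    simp only [Set.mem_ofPred_eq, Set.mem_sInter]
    refine ⟨fun h A hA => (h A hA.1).1 hA.2, fun h A hA => ⟨fun hω => h A ⟨hA, hω⟩, fun hω' => ?_⟩⟩
    by_contra hω
    exact h Aᶜ ⟨hA.compl, hω⟩ hω'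
  rw [h]
  exact MeasurableSet.sInter (Set.toFinite _).countable fun A hA => hA.1

theorem AtomConst.measurable {f : Ω → ℝ} (hf : AtomConst m f) : Measurable[m] f := by
  intro B _
  have h : f ⁻¹' B = ⋃ ω ∈ f ⁻¹' B, {ω' | sameAtom m ω ω'} := by
    ext ω'
    simp only [Set.mem_iUnion, Set.mem_ofPred_eq, Set.mem_preimage, exists_prop]
    refine ⟨fun h => ⟨ω', h, sameAtom.refl m ω'⟩, ?_⟩
    rintro ⟨ω, hω, h⟩
    rwa [← hf ω ω' h]
  rw [h]
  exact MeasurableSet.biUnion (Set.toFinite _).countable fun ω _ => measurableSet_atom m ω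

/-- The sum of `f` over the atom of `ω`. -/
def atomSum (m : MeasurableSpace Ω) (f : Ω → ℝ) (ω : Ω) : ℝ :=
  ∑ ω' : Ω, Set.indicator {ω'' | sameAtom m ω ω''} f ω'

theorem condExp_eq_div (m : MeasurableSpace Ω) (P f : Ω → ℝ) (ω : Ω) :
    condExp m P f ω = atomSum m (fun ω' => P ω' * f ω') ω / atomSum m P ω := rfl

theorem atomSum_eq_sum_indicator_mul (m : MeasurableSpace Ω) (f : Ω → ℝ) (ω : Ω) :
    atomSum m f ω = ∑ ω', Set.indicator {ω'' | sameAtom m ω ω''} (fun _ => 1) ω' * f ω' := by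
  refine Finset.sum_congr rfl fun ω' _ => ?_
  by_cases h : sameAtom m ω ω' <;> simp [h]

theorem atomConst_atomSum (m : MeasurableSpace Ω) (f : Ω → ℝ) : AtomConst m (atomSum m f) := by
  intro ω ω' h
  have : {ω'' | sameAtom m ω ω''} = {ω'' | sameAtom m ω' ω''} :=
    Set.ext fun _ => ⟨h.symm.trans, h.trans⟩
  simp only [atomSum, this]

theorem AtomConst.atomSum_mul {g : Ω → ℝ} (hg : AtomConst m g) (f : Ω → ℝ) (ω : Ω) :
    atomSum m (fun ω' => g ω' * f ω') ω = g ω * atomSum m f ω := by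
  simp only [atomSum, Finset.mul_sum]
  refine Finset.sum_congr rfl fun ω' _ => ?_
  by_cases h : sameAtom m ω ω'
  · simp [h, hg ω ω' h]
  · simp [h]

theorem atomSum_add (m : MeasurableSpace Ω) (f g : Ω → ℝ) (ω : Ω) :
    atomSum m (fun ω' => f ω' + g ω') ω = atomSum m f ω + atomSum m g ω := by
  simp only [atomSum_eq_sum_indicator_mul, mul_add, Finset.sum_add_distrib]

theorem atomSum_const_mul (m : MeasurableSpace Ω) (c : ℝ) (f : Ω → ℝ) (ω : Ω) :
    atomSum m (fun ω' => c * f ω') ω = c * atomSum m f ω :=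
  AtomConst.atomSum_mul (g := fun _ => c) (fun _ _ _ => rfl) f ω

theorem atomSum_nonneg {f : Ω → ℝ} (hf : ∀ ω, 0 ≤ f ω) (ω : Ω) : 0 ≤ atomSum m f ω :=
  Finset.sum_nonneg fun _ _ => Set.indicator_nonneg (fun ω _ => hf ω) _

theorem le_atomSum {f : Ω → ℝ} (hf : ∀ ω, 0 ≤ f ω) {ω ω' : Ω} (h : sameAtom m ω ω') :
    f ω' ≤ atomSum m f ω := by
  have := Finset.single_le_sum (f := Set.indicator {ω'' | sameAtom m ω ω''} f)
    (fun _ _ => Set.indicator_nonneg (fun ω _ => hf ω) _) (Finset.mem_univ ω')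
  rwa [Set.indicator_of_mem (show ω' ∈ {ω'' | sameAtom m ω ω''} from h)] at this

theorem atomSum_pos {f : Ω → ℝ} (hf : ∀ ω, 0 < f ω) (ω : Ω) : 0 < atomSum m f ω :=
  (hf ω).trans_le (le_atomSum (fun ω => (hf ω).le) (sameAtom.refl m ω))

/-- Summation over atoms is self-adjoint. -/
theorem sum_mul_atomSum (m : MeasurableSpace Ω) (f g : Ω → ℝ) :
    ∑ ω, g ω * atomSum m f ω = ∑ ω, atomSum m g ω * f ω := by
  simp only [atomSum, Finset.mul_sum, Finset.sum_mul]
  rw [Finset.sum_comm]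
  refine Finset.sum_congr rfl fun ω _ => Finset.sum_congr rfl fun ω' _ => ?_
  by_cases h : sameAtom m ω ω'
  · simp [h, h.symm]
  · have h' : ¬ sameAtom m ω' ω := fun h' => h h'.symm
    simp [h, h']

/-- Integrals of atomwise constant functions only depend on the atom sums of the density. -/
theorem AtomConst.sum_mul_congr {Y f g : Ω → ℝ} (hY : AtomConst m Y)
    (h : ∀ ω, atomSum m f ω = atomSum m g ω) :
    ∑ ω, Y ω * f ω = ∑ ω, Y ω * g ω := by
  let w : Ω → ℝ := atomSum m fun _ => 1
  have hw : ∀ ω, w ω ≠ 0 := fun ω => (atomSum_pos (fun _ => one_pos) ω).ne'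
  have hwc : AtomConst m w := atomConst_atomSum m _
  have key : ∀ f : Ω → ℝ, ∑ ω, Y ω * f ω = ∑ ω, (Y ω / w ω) * atomSum m f ω := by
    intro f
    rw [sum_mul_atomSum]
    refine Finset.sum_congr rfl fun ω _ => ?_
    have hc : AtomConst m fun ω => Y ω / w ω := fun ω ω' h => by
      simp only [hY ω ω' h, hwc ω ω' h]
    have := hc.atomSum_mul (fun _ => 1) ω
    simp only [mul_one] at this
    rw [this, div_mul_cancel₀ _ (hw ω)]
  rw [key f, key g]
  simp only [h]

end AtomSums

section Mixture

variable {M} {χ : ℕ → Ω → ℝ} {P Pbar : Ω → ℝ} {S Sbar : ℕ → Ω → ℝ} {ε : ℝ}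

theorem IsMixedStop.atomConst (hχ : IsMixedStop M χ) {t : ℕ} (ht : t ≤ M.T) :
    AtomConst (M.F t) (χ t) :=
  .of_measurable (hχ.1 t ht)

/-- `χ*_{t+1}` is already known at time `t`. -/
theorem IsMixedStop.atomConst_chiStar (hχ : IsMixedStop M χ) {t : ℕ} (ht : t ≤ M.T) :
    AtomConst (M.F t) (chiStar M χ (t + 1)) := by
  have key : ∀ ω, chiStar M χ (t + 1) ω = 1 - ∑ s ∈ Finset.range (t + 1), χ s ω := by
    intro ω
    rw [← hχ.2.2 ω, ← Finset.sum_range_add_sum_Ico _ (Nat.succ_le_succ ht)]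
    simp only [chiStar, Nat.succ_eq_add_one, add_sub_cancel_left]
    rfl
  intro ω ω' h
  rw [key, key]
  refine congrArg _ (Finset.sum_congr rfl fun s hs => ?_)
  have hs : s ≤ t := Nat.lt_succ_iff.1 (Finset.mem_range.1 hs)
  exact (hχ.atomConst (hs.trans ht)).mono (M.F_mono hs) ω ω' h

/-- A martingale has the same integral against an `F_t`-measurable function at all later times. -/
theorem sum_mul_martingale_eq (hP : ∀ ω, 0 < P ω) (hS : IsAdapted M S)
    (hmart : ∀ t, t < M.T → ∀ ω, 0 < P ω → condExp (M.F t) P (S (t + 1)) ω = S t ω)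
    {t s : ℕ} (hts : t ≤ s) (hs : s ≤ M.T) {Y : Ω → ℝ} (hY : AtomConst (M.F t) Y) :
    ∑ ω, Y ω * (P ω * S s ω) = ∑ ω, Y ω * (P ω * S t ω) := by
  induction s, hts using Nat.le_induction with
  | base => rfl
  | succ s hts ih =>
    rw [← ih (Nat.le_of_succ_le hs)]
    refine (hY.mono (M.F_mono hts)).sum_mul_congr fun ω => ?_
    have h := hmart s hs ω (hP ω)
    rw [condExp_eq_div, div_eq_iff (atomSum_pos hP ω).ne'] at h
    rw [h, ← (AtomConst.of_measurable (hS s (Nat.le_of_succ_le hs))).atomSum_mul]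
    simp only [mul_comm]

theorem sum_mul_starVal (χ Z : ℕ → Ω → ℝ) (Y P : Ω → ℝ) (t : ℕ) :
    ∑ ω, Y ω * (P ω * starVal M χ Z t ω) =
      ∑ s ∈ Finset.Icc t M.T, ∑ ω, (Y ω * χ s ω) * (P ω * Z s ω) := by
  rw [Finset.sum_comm]
  simp only [starVal, Finset.mul_sum]
  refine Finset.sum_congr rfl fun ω _ => Finset.sum_congr rfl fun s _ => ?_
  ring

theorem atomSum_starVal_martingale (hχ : IsMixedStop M χ) (hP : ∀ ω, 0 < P ω)
    (hS : IsAdapted M S)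
    (hmart : ∀ t, t < M.T → ∀ ω, 0 < P ω → condExp (M.F t) P (S (t + 1)) ω = S t ω)
    {t : ℕ} (ht : t ≤ M.T) (ω : Ω) :
    atomSum (M.F t) (fun ω' => P ω' * starVal M χ S (t + 1) ω') ω =
      chiStar M χ (t + 1) ω * S t ω * atomSum (M.F t) P ω := by
  have hA := atomConst_indicator_atom (M.F t) ω
  have hc := hχ.atomConst_chiStar ht
  have hSt := AtomConst.of_measurable (hS t ht)
  rw [atomSum_eq_sum_indicator_mul, sum_mul_starVal, ← (hc.mul hSt).atomSum_mul,
    atomSum_eq_sum_indicator_mul]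
  set Y := Set.indicator {ω'' | sameAtom (M.F t) ω ω''} (fun _ => (1 : ℝ))
  calc ∑ s ∈ Finset.Icc (t + 1) M.T, ∑ ω, (Y ω * χ s ω) * (P ω * S s ω)
      = ∑ s ∈ Finset.Icc (t + 1) M.T, ∑ ω, (Y ω * χ s ω) * (P ω * S M.T ω) := by
        refine Finset.sum_congr rfl fun s hs => ?_
        obtain ⟨h1, h2⟩ := Finset.mem_Icc.1 hs
        exact (sum_mul_martingale_eq hP hS hmart h2 le_rfl
          ((hA.mono (M.F_mono (Nat.le_of_succ_le h1))).mul (hχ.atomConst h2))).symm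
    _ = ∑ ω, (Y ω * chiStar M χ (t + 1) ω) * (P ω * S M.T ω) := by
        rw [Finset.sum_comm]
        simp only [chiStar, Finset.mul_sum, Finset.sum_mul]
    _ = ∑ ω, (Y ω * chiStar M χ (t + 1) ω) * (P ω * S t ω) :=
        sum_mul_martingale_eq hP hS hmart ht le_rfl (hA.mul hc)
    _ = ∑ ω, Y ω * (chiStar M χ (t + 1) ω * S t ω * P ω) :=
        Finset.sum_congr rfl fun ω _ => by ring

/-- The convex combination of two measures. -/
def mixMeasure {α : Type*} (ε : ℝ) (Pbar P : α → ℝ) (ω : α) : ℝ := (1 - ε) * Pbar ω + ε * P ω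

/-- The average of two processes, weighted by the masses of the atoms at each time. -/
def mixProcess (M : Market Ω) (ε : ℝ) (Pbar P : Ω → ℝ) (Sbar S : ℕ → Ω → ℝ) (t : ℕ) (ω : Ω) : ℝ :=
  ((1 - ε) * atomSum (M.F t) Pbar ω * Sbar t ω + ε * atomSum (M.F t) P ω * S t ω) /
    atomSum (M.F t) (mixMeasure ε Pbar P) ω

theorem atomSum_mixMeasure (m : MeasurableSpace Ω) (ε : ℝ) (Pbar P : Ω → ℝ) (ω : Ω) :
    atomSum m (mixMeasure ε Pbar P) ω = (1 - ε) * atomSum m Pbar ω + ε * atomSum m P ω := by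
  rw [← atomSum_const_mul, ← atomSum_const_mul, ← atomSum_add]
  rfl

theorem mixMeasure_pos {α : Type*} {Pbar P : α → ℝ} (hε : 0 < ε) (hε1 : ε ≤ 1)
    (hPbar : ∀ ω, 0 ≤ Pbar ω) (hP : ∀ ω, 0 < P ω) (ω : α) : 0 < mixMeasure ε Pbar P ω :=
  add_pos_of_nonneg_of_pos (mul_nonneg (sub_nonneg.2 hε1) (hPbar ω)) (mul_pos hε (hP ω))

theorem atomConst_mixProcess {t : ℕ} (hSbar : AtomConst (M.F t) (Sbar t))
    (hS : AtomConst (M.F t) (S t)) :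
    AtomConst (M.F t) (mixProcess M ε Pbar P Sbar S t) := by
  intro ω ω' h
  simp only [mixProcess, hSbar ω ω' h, hS ω ω' h, atomConst_atomSum (M.F t) _ ω ω' h]

/-- The pair `(P, S) ↦ P S_t` is mixed linearly when tested against `F_t`-measurable functions. -/
theorem sum_mul_mixProcess (hpos : ∀ ω, 0 < mixMeasure ε Pbar P ω) {t : ℕ}
    (hSbar : AtomConst (M.F t) (Sbar t)) (hS : AtomConst (M.F t) (S t))
    {Y : Ω → ℝ} (hY : AtomConst (M.F t) Y) :
    ∑ ω, Y ω * (mixMeasure ε Pbar P ω * mixProcess M ε Pbar P Sbar S t ω) =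
      (1 - ε) * ∑ ω, Y ω * (Pbar ω * Sbar t ω) + ε * ∑ ω, Y ω * (P ω * S t ω) := by
  have h : ∀ ω, atomSum (M.F t)
      (fun ω => mixMeasure ε Pbar P ω * mixProcess M ε Pbar P Sbar S t ω) ω =
      atomSum (M.F t)
        (fun ω => (1 - ε) * (Sbar t ω * Pbar ω) + ε * (S t ω * P ω)) ω := by
    intro ω
    rw [atomSum_add, atomSum_const_mul, atomSum_const_mul, hSbar.atomSum_mul, hS.atomSum_mul]
    simp only [mul_comm (mixMeasure ε Pbar P _)]
    rw [(atomConst_mixProcess hSbar hS).atomSum_mul, mixProcess,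
      div_mul_cancel₀ _ (atomSum_pos hpos ω).ne']
    ring
  rw [hY.sum_mul_congr h, Finset.mul_sum, Finset.mul_sum, ← Finset.sum_add_distrib]
  exact Finset.sum_congr rfl fun ω _ => by ring

theorem atomSum_starVal_mixProcess (hχ : IsMixedStop M χ)
    (hpos : ∀ ω, 0 < mixMeasure ε Pbar P ω) (hSbar : IsAdapted M Sbar) (hS : IsAdapted M S)
    (t : ℕ) (ω : Ω) :
    atomSum (M.F t) (fun ω' => mixMeasure ε Pbar P ω' *
        starVal M χ (mixProcess M ε Pbar P Sbar S) (t + 1) ω') ω =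
      (1 - ε) * atomSum (M.F t) (fun ω' => Pbar ω' * starVal M χ Sbar (t + 1) ω') ω +
        ε * atomSum (M.F t) (fun ω' => P ω' * starVal M χ S (t + 1) ω') ω := by
  simp only [atomSum_eq_sum_indicator_mul, sum_mul_starVal]
  rw [Finset.mul_sum, Finset.mul_sum, ← Finset.sum_add_distrib]
  refine Finset.sum_congr rfl fun s hs => ?_
  obtain ⟨h1, h2⟩ := Finset.mem_Icc.1 hs
  exact sum_mul_mixProcess hpos (.of_measurable (hSbar s h2)) (.of_measurable (hS s h2))
    (((atomConst_indicator_atom (M.F t) ω).mono (M.F_mono (Nat.le_of_succ_le h1))).mul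
      (hχ.atomConst h2))

theorem expect_mixVal_mixProcess (hχ : IsMixedStop M χ)
    (hpos : ∀ ω, 0 < mixMeasure ε Pbar P ω) (hSbar : IsAdapted M Sbar) (hS : IsAdapted M S)
    {ζ : ℕ → Ω → ℝ} (hζ : IsAdapted M ζ) (ξ : ℕ → Ω → ℝ) :
    expect (mixMeasure ε Pbar P)
        (mixVal M χ fun t ω => ξ t ω + mixProcess M ε Pbar P Sbar S t ω * ζ t ω) =
      (1 - ε) * expect Pbar (mixVal M χ fun t ω => ξ t ω + Sbar t ω * ζ t ω) +
        ε * expect P (mixVal M χ fun t ω => ξ t ω + S t ω * ζ t ω) := by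
  have key : ∀ (p : Ω → ℝ) (s : ℕ → Ω → ℝ),
      expect p (mixVal M χ fun t ω => ξ t ω + s t ω * ζ t ω) =
        ∑ t ∈ Finset.range (M.T + 1), ((∑ ω, χ t ω * ξ t ω * p ω) +
          ∑ ω, (χ t ω * ζ t ω) * (p ω * s t ω)) := by
    intro p s
    simp only [expect, mixVal, Finset.mul_sum, ← Finset.sum_add_distrib]
    rw [Finset.sum_comm]
    exact Finset.sum_congr rfl fun t _ => Finset.sum_congr rfl fun ω _ => by ring
  simp only [key]
  rw [Finset.mul_sum, Finset.mul_sum, ← Finset.sum_add_distrib]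
  refine Finset.sum_congr rfl fun t ht => ?_
  have ht : t ≤ M.T := Nat.lt_succ_iff.1 (Finset.mem_range.1 ht)
  rw [sum_mul_mixProcess hpos (.of_measurable (hSbar t ht)) (.of_measurable (hS t ht))
    ((hχ.atomConst ht).mul (.of_measurable (hζ t ht)))]
  have hξ : ∑ ω, χ t ω * ξ t ω * mixMeasure ε Pbar P ω =
      (1 - ε) * ∑ ω, χ t ω * ξ t ω * Pbar ω + ε * ∑ ω, χ t ω * ξ t ω * P ω := by
    rw [Finset.mul_sum, Finset.mul_sum, ← Finset.sum_add_distrib]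
    exact Finset.sum_congr rfl fun ω _ => by simp only [mixMeasure]; ring
  rw [hξ]
  ring

theorem memBarP.atomSum_starVal_bounds (hχ : IsMixedStop M χ) (h : memBarP M χ Pbar Sbar)
    {t : ℕ} (ht : t ≤ M.T) (ω : Ω) :
    chiStar M χ (t + 1) ω * M.Sb t ω * atomSum (M.F t) Pbar ω ≤
        atomSum (M.F t) (fun ω' => Pbar ω' * starVal M χ Sbar (t + 1) ω') ω ∧
      atomSum (M.F t) (fun ω' => Pbar ω' * starVal M χ Sbar (t + 1) ω') ω ≤
        chiStar M χ (t + 1) ω * M.Sa t ω * atomSum (M.F t) Pbar ω := by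
  obtain ⟨hPbar, -, -, -, hbd⟩ := h
  by_cases hex : ∃ ω', sameAtom (M.F t) ω ω' ∧ 0 < Pbar ω'
  · obtain ⟨ω', hω', hp⟩ := hex
    have hpos : 0 < atomSum (M.F t) Pbar ω' :=
      hp.trans_le (le_atomSum hPbar (sameAtom.refl _ _))
    have := hbd t ht ω' hp
    rw [condExp_eq_div, le_div_iff₀ hpos, div_le_iff₀ hpos] at this
    rwa [hχ.atomConst_chiStar ht ω ω' hω',
      AtomConst.of_measurable (M.Sb_adapted t ht) ω ω' hω',
      AtomConst.of_measurable (M.Sa_adapted t ht) ω ω' hω',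
      atomConst_atomSum (M.F t) _ ω ω' hω', atomConst_atomSum (M.F t) _ ω ω' hω']
  · have hzero : ∀ ω', sameAtom (M.F t) ω ω' → Pbar ω' = 0 := fun ω' hω' =>
      le_antisymm (not_lt.1 fun hp => hex ⟨ω', hω', hp⟩) (hPbar ω')
    have hsum : ∀ f : Ω → ℝ, atomSum (M.F t) (fun ω' => Pbar ω' * f ω') ω = 0 := fun f =>
      Finset.sum_eq_zero fun ω' _ => by
        by_cases hω' : sameAtom (M.F t) ω ω'
        · simp [hω', hzero ω' hω']
        · simp [hω']
    have hone := hsum fun _ => 1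
    simp only [mul_one] at hone
    rw [hsum, show atomSum (M.F t) Pbar ω = 0 from hone]
    simp

/-- Mixing an element of barP(χ) with an equivalent martingale pair gives an element of P(χ). -/
theorem memP_mix (hχ : IsMixedStop M χ) (hbar : memBarP M χ Pbar Sbar)
    (hε : 0 < ε) (hε1 : ε ≤ 1) (hP : ∀ ω, 0 < P ω) (hP1 : ∑ ω, P ω = 1) (hS : IsAdapted M S)
    (hSbd : ∀ t ω, t ≤ M.T → M.Sb t ω ≤ S t ω ∧ S t ω ≤ M.Sa t ω)
    (hmart : ∀ t, t < M.T → ∀ ω, 0 < P ω → condExp (M.F t) P (S (t + 1)) ω = S t ω) :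
    memP M χ (mixMeasure ε Pbar P) (mixProcess M ε Pbar P Sbar S) := by
  have hpos := mixMeasure_pos hε hε1 hbar.1 hP
  have hstar := fun t ht ω => hbar.atomSum_starVal_bounds (t := t) hχ ht ω
  obtain ⟨hPbar, hPbar1, hSbar, hSbarbd, -⟩ := hbar
  have hε' : 0 ≤ 1 - ε := sub_nonneg.2 hε1
  refine ⟨⟨fun ω => (hpos ω).le, ?_, fun t ht => ?_, fun t ω ht => ?_, fun t ht ω _ => ?_⟩, hpos⟩
  · simp only [mixMeasure, Finset.sum_add_distrib, ← Finset.mul_sum, hPbar1, hP1]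
    ring
  · exact (atomConst_mixProcess (.of_measurable (hSbar t ht))
      (.of_measurable (hS t ht))).measurable
  · have hd := atomSum_pos (m := M.F t) hpos ω
    have ha := mul_nonneg hε' (atomSum_nonneg (m := M.F t) hPbar ω)
    have hb := mul_nonneg hε.le (atomSum_pos (m := M.F t) hP ω).le
    obtain ⟨h1, h2⟩ := hSbarbd t ω ht
    obtain ⟨h3, h4⟩ := hSbd t ω ht
    rw [mixProcess, le_div_iff₀ hd, div_le_iff₀ hd, atomSum_mixMeasure]
    constructor
    · linarith [mul_le_mul_of_nonneg_left h1 ha, mul_le_mul_of_nonneg_left h3 hb]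
    · linarith [mul_le_mul_of_nonneg_left h2 ha, mul_le_mul_of_nonneg_left h4 hb]
  · have hd := atomSum_pos (m := M.F t) hpos ω
    have hc : 0 ≤ chiStar M χ (t + 1) ω := Finset.sum_nonneg fun s _ => hχ.2.1 s ω
    have hb := mul_nonneg hc (mul_nonneg hε.le (atomSum_pos (m := M.F t) hP ω).le)
    obtain ⟨h1, h2⟩ := hstar t ht ω
    obtain ⟨h3, h4⟩ := hSbd t ω ht
    rw [condExp_eq_div, le_div_iff₀ hd, div_le_iff₀ hd,
      atomSum_starVal_mixProcess hχ hpos hSbar hS,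
      atomSum_starVal_martingale hχ hP hS hmart ht, atomSum_mixMeasure]
    constructor
    · linarith [mul_le_mul_of_nonneg_left h1 hε', mul_le_mul_of_nonneg_left h3 hb]
    · linarith [mul_le_mul_of_nonneg_left h2 hε', mul_le_mul_of_nonneg_left h4 hb]

end Mixture

/-- Proposition: any approximate-martingale expectation can be approximated within δ
by one whose probability measure is equivalent to Q. -/
theorem approx_by_equivalent_pair (hNA : ArbitrageFree M) (ξ ζ : ℕ → Ω → ℝ)
    (hpay : AdaptedPair M ξ ζ) :
    ∀ δ : ℝ, 0 < δ → ∀ χ, IsMixedStop M χ → ∀ Pbar Sbar, memBarP M χ Pbar Sbar →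
      ∃ Pd Sd, memP M χ Pd Sd ∧
        |expect Pd (mixVal M χ fun t ω => ξ t ω + Sd t ω * ζ t ω) -
          expect Pbar (mixVal M χ fun t ω => ξ t ω + Sbar t ω * ζ t ω)| < δ := by
  intro δ hδ χ hχ Pbar Sbar hbar
  obtain ⟨P, S, hP, hP1, hS, hSbd, hmart⟩ := hNA
  set D := expect P (mixVal M χ fun t ω => ξ t ω + S t ω * ζ t ω) -
    expect Pbar (mixVal M χ fun t ω => ξ t ω + Sbar t ω * ζ t ω) with hD
  have hden : 0 < |D| + δ := by positivity
  have hε : 0 < δ / (|D| + δ) := by positivity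
  have hε1 : δ / (|D| + δ) ≤ 1 := (div_le_one hden).2 (by linarith [abs_nonneg D])
  refine ⟨_, _, memP_mix hχ hbar hε hε1 hP hP1 hS hSbd hmart, ?_⟩
  rw [expect_mixVal_mixProcess hχ (mixMeasure_pos hε hε1 hbar.1 hP) hbar.2.2.1 hS hpay.2]
  have hdiff : ∀ ε a b : ℝ, (1 - ε) * a + ε * b - a = ε * (b - a) := fun ε a b => by ring
  rw [hdiff, ← hD, abs_mul, abs_of_pos hε, div_mul_eq_mul_div, div_lt_iff₀ hden]
  nlinarith [abs_nonneg D]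

end RZ
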